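/- arXiv:1703.03756 — 2 statements merged into one kernel-verified Lean document; each statement's English description precedes it below -/
import Mathlib

section
/- Let S⃗ be a universe of set separations over a finite set V with the order function |X,Y|_r = r(X) + r(Y) − r(V) for a non-negative non-decreasing submodular function r : 2^V → ℕ, and let p ∈ ℕ. Then the family F_p of all stars σ in S⃗ with ⟨σ⟩_r < p is fixed under shifting. In particular, if σ = {(A_0,B_0), (A_1,B_1), …, (A_n,B_n)} is a star in S⃗, (A,B) ∈ S⃗ satisfies (A,B) ≤ (A_0,B_0), and (X,Y) is linked to (A,B), then the shifted star σ' = {(A_0 ∪ X, B_0 ∩ Y), (A_1 ∩ Y, B_1 ∪ X), …, (A_n ∩ Y, B_n ∪ X)} satisfies ⟨σ'⟩_r ≤ ⟨σ⟩_r. -/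
open scoped Classical

noncomputable section

/-- An oriented separation of `V`: an ordered pair of subsets. -/
abbrev OSep (V : Type*) := Set V × Set V

namespace OSep

/-- The involution `(A,B)* = (B,A)`. -/
def flip {V : Type*} (s : OSep V) : OSep V := (s.2, s.1)

/-- The partial order `(A,B) ≤ (C,D) iff A ⊆ C and D ⊆ B`. -/
def le {V : Type*} (s t : OSep V) : Prop := s.1 ⊆ t.1 ∧ t.2 ⊆ s.2

/-- The infimum `(A,B) ∧ (C,D) = (A ∩ C, B ∪ D)`. -/
def inter {V : Type*} (s t : OSep V) : OSep V := (s.1 ∩ t.1, s.2 ∪ t.2)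

/-- The supremum `(A,B) ∨ (C,D) = (A ∪ C, B ∩ D)`. -/
def union {V : Type*} (s t : OSep V) : OSep V := (s.1 ∪ t.1, s.2 ∩ t.2)

end OSep

/-- A universe of set separations: a set of oriented separations (pairs covering `V`)
closed under the involution and under ∧ and ∨. -/
structure IsUniverse {V : Type*} (S : Set (OSep V)) : Prop where
  covers : ∀ s ∈ S, s.1 ∪ s.2 = Set.univ
  flip_mem : ∀ s ∈ S, s.flip ∈ S
  inter_mem : ∀ s ∈ S, ∀ t ∈ S, s.inter t ∈ S
  union_mem : ∀ s ∈ S, ∀ t ∈ S, s.union t ∈ S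

/-- An order function on a universe `S`: symmetric and submodular (non-negativity is
automatic for `ℕ`-valued functions). -/
structure IsOrderFun {V : Type*} (S : Set (OSep V)) (ord : OSep V → ℕ) : Prop where
  symm : ∀ s ∈ S, ord s.flip = ord s
  submod : ∀ s ∈ S, ∀ t ∈ S, ord (s.inter t) + ord (s.union t) ≤ ord s + ord t

/-- A universe with an order function is grounded if `|A ∪ C, B ∩ D| ≤ |C,D|`
whenever `(B,A) ≤ (C,D)`. -/
def Grounded {V : Type*} (S : Set (OSep V)) (ord : OSep V → ℕ) : Prop :=
  ∀ s ∈ S, ∀ t ∈ S, OSep.le s.flip t → ord (s.union t) ≤ ord t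

/-- A submodular function on subsets of `V`. -/
def Submodular {V : Type*} (r : Set V → ℕ) : Prop :=
  ∀ X Y : Set V, r (X ∩ Y) + r (X ∪ Y) ≤ r X + r Y

/-- The order function `|X,Y|_r = r(X) + r(Y) - r(V)` induced by `r`. -/
def ordOf {V : Type*} (r : Set V → ℕ) (s : OSep V) : ℕ := r s.1 + r s.2 - r Set.univ

/-- A multiset of oriented separations is a star if `(A,B) ≤ (D,C)` for every two of its
members occupying distinct positions. -/
def IsStar {V : Type*} (σ : Multiset (OSep V)) : Prop :=
  ∀ a b : OSep V, (a ::ₘ {b}) ≤ σ → OSep.le a b.flip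

/-- The size `⟨σ⟩_r = Σᵢ r(Bᵢ) − n · r(V)` of a star `σ = {(A₀,B₀),…,(Aₙ,Bₙ)}`. -/
def starSize {V : Type*} (r : Set V → ℕ) (σ : Multiset (OSep V)) : ℕ :=
  (σ.map fun s => r s.2).sum - (Multiset.card σ - 1) * r Set.univ

/-- `λ((A,B),(C,D)) = min { |X,Y| : (X,Y) ∈ S, (A,B) ≤ (X,Y) ≤ (C,D) }`. -/
def lam {V : Type*} (S : Set (OSep V)) (ord : OSep V → ℕ) (a c : OSep V) : ℕ :=
  sInf (ord '' {s | s ∈ S ∧ OSep.le a s ∧ OSep.le s c})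

/-- `(X,Y)` is linked to `(A,B)` if `(A,B) ≤ (X,Y)` and `|X,Y| = λ((A,B),(X,Y))`. -/
def IsLinkedSep {V : Type*} (S : Set (OSep V)) (ord : OSep V → ℕ) (a x : OSep V) : Prop :=
  x ∈ S ∧ OSep.le a x ∧ ord x = lam S ord a x

/-- `σ_t`: the multiset of labels of the oriented edges (darts) pointing towards `t`. -/
def starAt {W : Type*} [Fintype W] {V : Type*} (T : SimpleGraph W) (α : T.Dart → OSep V)
    (t : W) : Multiset (OSep V) :=
  ((Finset.univ : Finset T.Dart).filter fun d => d.toProd.2 = t).val.map α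

/-- The natural ordering on the oriented edges (darts) of a tree: `d ≤ d'` iff both lie
(in that direction) on the path from the tail of `d` to the head of `d'`. -/
def dartLE {W : Type*} (T : SimpleGraph W) (d d' : T.Dart) : Prop :=
  ∀ p : T.Walk d.toProd.1 d'.toProd.2, p.IsPath → d ∈ p.darts ∧ d' ∈ p.darts

/-- The vertex set of the subtree `T(e⃗)`: the component of `T - x` containing `y` together
with `x` itself, for `e⃗ = (x,y)`. -/
def shiftSet {W : Type*} (T : SimpleGraph W) (e : T.Dart) : Set W :=
  {v | v = e.toProd.1 ∨ ∀ p : T.Walk e.toProd.1 v, p.IsPath → e ∈ p.darts}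

/-- A dart of an induced subgraph, as a dart of the ambient graph. -/
def liftDart {W : Type*} {T : SimpleGraph W} {U : Set W} (d : (T.induce U).Dart) : T.Dart :=
  ⟨(d.toProd.1.val, d.toProd.2.val), d.adj⟩

/-- The labelling `α'` of the shift of `(T,α)` onto `(X,Y)` with respect to `e⃗`:
a dart `f` of `T(e⃗)` with `e⃗ ≤ f⃗` gets `α(f⃗) ∨ (X,Y)`, and the reverse darts get the
flipped labels. -/
def shiftAlpha {W : Type*} {V : Type*} (T : SimpleGraph W) (α : T.Dart → OSep V)
    (e : T.Dart) (X : OSep V) : (T.induce (shiftSet T e)).Dart → OSep V :=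
  fun d =>
    if dartLE T e (liftDart d) then (α (liftDart d)).union X
    else ((α (liftDart d).symm).union X).flip

/-- A family `F` of stars is fixed under shifting if for every tame `S`-tree `(T,α)`,
every oriented edge `e⃗ = (t,t')` of `T`, every vertex `s ≠ t` of `T(e⃗)` with
`α(F⃗_s) ∈ F`, and every `(X,Y)` linked to `α(e⃗)`, in the shift of `(T,α)` onto `(X,Y)`
with respect to `e⃗` one has `α'(F⃗_s) ∈ F`. -/
def FixedUnderShifting {V : Type*} (S : Set (OSep V)) (ord : OSep V → ℕ)
    (F : Set (Multiset (OSep V))) : Prop :=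
  ∀ (n : ℕ) (T : SimpleGraph (Fin n)) (α : T.Dart → OSep V) (e : T.Dart) (X : OSep V)
    (s : ↥(shiftSet T e)),
    T.IsTree → (∀ d, α d.symm = (α d).flip) → (∀ d, α d ∈ S) →
    (∀ t, IsStar (starAt T α t)) →
    (s : Fin n) ≠ e.toProd.1 → starAt T α (s : Fin n) ∈ F →
    IsLinkedSep S ord (α e) X →
    starAt (T.induce (shiftSet T e)) (shiftAlpha T α e X) s ∈ F

/-- A linked `S_k`-tree: for every two darts `e⃗ ≤ f⃗`, the minimum order of a label on the
path from `e` to `f` equals `λ(α(e⃗), α(f⃗))`. -/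
def IsLinkedTree {W : Type*} {V : Type*} (S : Set (OSep V)) (ord : OSep V → ℕ)
    (T : SimpleGraph W) (α : T.Dart → OSep V) : Prop :=
  ∀ e f : T.Dart, dartLE T e f →
    sInf ((fun g => ord (α g)) '' {g | dartLE T e g ∧ dartLE T g f}) =
      lam S ord (α e) (α f)

/-- An `F`-lean `S_k`-tree with respect to the ground function `r`. -/
def IsLeanTree {W : Type*} [Fintype W] {V : Type*} (S : Set (OSep V)) (ord : OSep V → ℕ)
    (r : Set V → ℕ) (T : SimpleGraph W) (α : T.Dart → OSep V)
    (F : Set (Multiset (OSep V))) : Prop :=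
  ∀ (t t' : W) (a b : OSep V), OSep.le a b.flip →
    (a ::ₘ starAt T α t) ∈ F → (b ::ₘ starAt T α t') ∈ F →
    (min (r a.1) (r b.1) ≤ lam S ord a b.flip ∨
      ∀ p : T.Walk t t', p.IsPath →
        sInf ((fun d => ord (α d)) '' {d | d ∈ p.darts}) = lam S ord a b.flip)

/-- `int(σ) = ⋂ᵢ Bᵢ` for `σ = {(A₀,B₀),…,(Aₙ,Bₙ)}`. -/
def intStar {V : Type*} (σ : Multiset (OSep V)) : Set V := {v | ∀ s ∈ σ, v ∈ s.2}

/-- The universe of oriented separations of a graph `G`: pairs `(A,B)` of vertex sets with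
`A ∪ B = V(G)` and no edge between `A ∖ B` and `B ∖ A`. -/
def graphSeps {V : Type*} (G : SimpleGraph V) : Set (OSep V) :=
  {s | s.1 ∪ s.2 = Set.univ ∧ ∀ a ∈ s.1 \ s.2, ∀ b ∈ s.2 \ s.1, ¬ G.Adj a b}

/-- `G` contains `k` vertex-disjoint `Z₁`–`Z₂` paths. -/
def HasDisjointPaths {V : Type*} (G : SimpleGraph V) (Z₁ Z₂ : Set V) (k : ℕ) : Prop :=
  ∃ (u v : Fin k → V) (p : ∀ i, G.Walk (u i) (v i)),
    (∀ i, (p i).IsPath) ∧ (∀ i, u i ∈ Z₁) ∧ (∀ i, v i ∈ Z₂) ∧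
    ∀ i j, i ≠ j → ∀ x, x ∈ (p i).support → x ∉ (p j).support

/-- `(T, B)` is a tree-decomposition of the graph `G`. -/
def IsTreeDecomp {V : Type*} {n : ℕ} (G : SimpleGraph V) (T : SimpleGraph (Fin n))
    (B : Fin n → Set V) : Prop :=
  T.IsTree ∧ (∀ v, ∃ t, v ∈ B t) ∧ (∀ u w, G.Adj u w → ∃ t, u ∈ B t ∧ w ∈ B t) ∧
  (∀ t₁ t₂ t₃ : Fin n, ∀ p : T.Walk t₁ t₃, p.IsPath → t₂ ∈ p.support → B t₁ ∩ B t₃ ⊆ B t₂)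

/-- The width of a tree-decomposition: `max |V_t| − 1`. -/
def tdWidth {V : Type*} {n : ℕ} (B : Fin n → Set V) : ℕ :=
  (Finset.univ.sup fun t => (B t).ncard) - 1

/-- The tree-width of a graph. -/
def treeWidth {V : Type*} (G : SimpleGraph V) : ℕ :=
  sInf {w | ∃ (n : ℕ) (T : SimpleGraph (Fin n)) (B : Fin n → Set V),
    IsTreeDecomp G T B ∧ tdWidth B = w}

/-- The path-width of a graph: minimum width of a tree-decomposition whose tree is a path. -/
def pathWidth {V : Type*} (G : SimpleGraph V) : ℕ :=
  sInf {w | ∃ (n : ℕ) (B : Fin n → Set V),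
    IsTreeDecomp G (SimpleGraph.pathGraph n) B ∧ tdWidth B = w}

/-- A linked tree-decomposition of a graph. -/
def IsLinkedDecomp {V : Type*} {n : ℕ} (G : SimpleGraph V) (T : SimpleGraph (Fin n))
    (B : Fin n → Set V) : Prop :=
  ∀ (k : ℕ) (t t' : Fin n),
    HasDisjointPaths G (B t) (B t') k ∨
    ∀ p : T.Walk t t', p.IsPath →
      ∃ d ∈ p.darts, (B d.toProd.1 ∩ B d.toProd.2).ncard < k

/-- A lean tree-decomposition of a graph. -/
def IsLeanDecomp {V : Type*} {n : ℕ} (G : SimpleGraph V) (T : SimpleGraph (Fin n))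
    (B : Fin n → Set V) : Prop :=
  ∀ (k : ℕ) (t t' : Fin n) (Z₁ Z₂ : Set V), Z₁ ⊆ B t → Z₂ ⊆ B t' →
    Z₁.ncard = k → Z₂.ncard = k →
    HasDisjointPaths G Z₁ Z₂ k ∨
    ∀ p : T.Walk t t', p.IsPath →
      ∃ d ∈ p.darts, (B d.toProd.1 ∩ B d.toProd.2).ncard < k
/-- The rank function of a matroid: `r(X)` is the maximum size of an independent subset
of `X`. -/
def mRank {α : Type*} (M : Matroid α) (X : Set α) : ℕ :=
  sSup {k | ∃ I, I ⊆ X ∧ M.Indep I ∧ I.ncard = k}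

/-- The connectivity `λ(X) = r(X) + r(E ∖ X) − r(E)` of `X ⊆ E`. -/
def mConn {α : Type*} (M : Matroid α) (X : Set α) : ℕ :=
  mRank M X + mRank M Xᶜ - mRank M Set.univ

/-- For a dart `d = (s,s')` of a tree `T`, the component of `T − s'` containing `s`. -/
def branch {W : Type*} (T : SimpleGraph W) (d : T.Dart) : Set W :=
  {w | ∀ p : T.Walk d.toProd.2 w, p.IsPath → d.toProd.1 ∈ p.support}

/-- The darts of `T` pointing towards `t`. -/
def dartsTo {W : Type*} [Fintype W] (T : SimpleGraph W) (t : W) : Finset T.Dart :=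
  Finset.univ.filter fun d => d.toProd.2 = t

/-- The width `Σᵢ r(E ∖ τ⁻¹(Tᵢ)) − (d−1)·r(E)` of the bag of a matroid tree-decomposition
at `v`, where the `Tᵢ` are the components of `T − v`. -/
def mBagWidth {α : Type*} {n : ℕ} (M : Matroid α) (T : SimpleGraph (Fin n))
    (τ : α → Fin n) (v : Fin n) : ℕ :=
  ((∑ d ∈ dartsTo T v, mRank M ((τ ⁻¹' branch T d)ᶜ)) + mRank M Set.univ)
    - (dartsTo T v).card * mRank M Set.univ

/-- The width of a matroid tree-decomposition: the maximum width of a bag. -/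
def mWidth {α : Type*} {n : ℕ} (M : Matroid α) (T : SimpleGraph (Fin n))
    (τ : α → Fin n) : ℕ :=
  Finset.univ.sup (mBagWidth M T τ)

/-- The tree-width of a matroid. -/
def matroidTreeWidth {α : Type*} (M : Matroid α) : ℕ :=
  sInf {w | ∃ (n : ℕ) (T : SimpleGraph (Fin n)) (_ : T.IsTree) (τ : α → Fin n),
    mWidth M T τ = w}

/-- `λ(Z₁,Z₂) = min {λ(X) : Z₁ ⊆ X ⊆ E ∖ Z₂}` for disjoint `Z₁, Z₂ ⊆ E`. -/
def mLam {α : Type*} (M : Matroid α) (Z₁ Z₂ : Set α) : ℕ :=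
  sInf (mConn M '' {X | Z₁ ⊆ X ∧ X ⊆ Z₂ᶜ})

/-- A lean matroid tree-decomposition. -/
def IsLeanMDecomp {α : Type*} {n : ℕ} (M : Matroid α) (T : SimpleGraph (Fin n))
    (τ : α → Fin n) : Prop :=
  ∀ (k : ℕ) (t t' : Fin n) (Z₁ Z₂ : Set α), Z₁ ⊆ τ ⁻¹' {t} → Z₂ ⊆ τ ⁻¹' {t'} →
    Disjoint Z₁ Z₂ → mRank M Z₁ = k → mRank M Z₂ = k →
    k ≤ mLam M Z₁ Z₂ ∨
    ∀ p : T.Walk t t', p.IsPath → ∃ d ∈ p.darts, mConn M (τ ⁻¹' branch T d) < k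

/-- A linked matroid tree-decomposition. -/
def IsLinkedMDecomp {α : Type*} {n : ℕ} (M : Matroid α) (T : SimpleGraph (Fin n))
    (τ : α → Fin n) : Prop :=
  ∀ e f : T.Dart, dartLE T e f →
    sInf ((fun g => mConn M (τ ⁻¹' branch T g)) '' {g | dartLE T e g ∧ dartLE T g f}) =
      sInf (mConn M '' {X | τ ⁻¹' branch T e ⊆ X ∧ X ⊆ τ ⁻¹' branch T f})
/-- Two oriented separations are nested if they have `≤`-comparable orientations. -/
def Nested {V : Type*} (s t : OSep V) : Prop :=
  OSep.le s t ∨ OSep.le s t.flip ∨ OSep.le s.flip t ∨ OSep.le s.flip t.flip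

namespace OSep

variable {V : Type*}

lemma le_refl (s : OSep V) : s.le s := ⟨subset_rfl, subset_rfl⟩

lemma le_trans {s t u : OSep V} (hst : s.le t) (htu : t.le u) : s.le u :=
  ⟨hst.1.trans htu.1, htu.2.trans hst.2⟩

lemma le_flip_symm {s t : OSep V} (h : s.le t.flip) : t.le s.flip := ⟨h.2, h.1⟩

lemma flip_union_flip (s x : OSep V) : (s.flip.union x).flip = s.inter x.flip := rfl

end OSep

lemma isStar_cons {V : Type*} {a : OSep V} {τ : Multiset (OSep V)} :
    IsStar (a ::ₘ τ) ↔ (∀ b ∈ τ, a.le b.flip) ∧ IsStar τ := by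
  constructor
  · intro h
    exact ⟨fun b hb => h a b (Multiset.cons_le_cons a (Multiset.singleton_le.2 hb)),
      fun c d hcd => h c d (hcd.trans (Multiset.le_cons_self τ a))⟩
  · rintro ⟨ha, hτ⟩ c d hcd
    by_cases hc : c = a
    · subst hc
      exact ha d (Multiset.singleton_le.1 ((Multiset.cons_le_cons_iff c).1 hcd))
    by_cases hd : d = a
    · subst hd
      rw [← Multiset.singleton_add, add_comm, Multiset.singleton_add] at hcd
      exact OSep.le_flip_symm
        (ha c (Multiset.singleton_le.1 ((Multiset.cons_le_cons_iff d).1 hcd)))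
    · refine hτ c d ((Multiset.le_cons_of_notMem ?_).1 hcd)
      simp [Ne.symm hc, Ne.symm hd]

lemma IsStar.map {V : Type*} {τ : Multiset (OSep V)} {f : OSep V → OSep V}
    (hf : ∀ s t : OSep V, s.le t.flip → (f s).le (f t).flip) (hτ : IsStar τ) :
    IsStar (τ.map f) := by
  induction τ using Multiset.induction_on with
  | empty => simpa using hτ
  | cons t τ ih =>
    rw [isStar_cons] at hτ
    rw [Multiset.map_cons, isStar_cons]
    refine ⟨fun b hb => ?_, ih hτ.2⟩
    obtain ⟨s, hs, rfl⟩ := Multiset.mem_map.1 hb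
    exact hf _ _ (hτ.1 s hs)

/-- The shift onto `x` of the star consisting of `s` and the elements of `τ`, where `s` is the
separation pointing away from `x`. -/
def shiftStar {V : Type*} (x s : OSep V) (τ : Multiset (OSep V)) : Multiset (OSep V) :=
  s.union x ::ₘ τ.map fun t => t.inter x.flip

lemma IsStar.shiftStar {V : Type*} {x s : OSep V} {τ : Multiset (OSep V)}
    (h : IsStar (s ::ₘ τ)) : IsStar (shiftStar x s τ) := by
  rw [isStar_cons] at h
  refine isStar_cons.2 ⟨fun b hb => ?_, h.2.map fun c d hcd => ?_⟩
  · obtain ⟨t, ht, rfl⟩ := Multiset.mem_map.1 hb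
    have hst := h.1 t ht
    exact ⟨Set.union_subset_union_left _ hst.1, Set.inter_subset_inter_left _ hst.2⟩
  · exact ⟨Set.inter_subset_left.trans (hcd.1.trans Set.subset_union_left),
      Set.inter_subset_left.trans (hcd.2.trans Set.subset_union_left)⟩

lemma IsUniverse.mem_of_mem_shiftStar {V : Type*} {S : Set (OSep V)} (hU : IsUniverse S)
    {x s : OSep V} {τ : Multiset (OSep V)} (hx : x ∈ S) (hS : ∀ t ∈ s ::ₘ τ, t ∈ S) :
    ∀ t ∈ shiftStar x s τ, t ∈ S := by
  intro t ht
  rcases Multiset.mem_cons.1 ht with rfl | ht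
  · exact hU.union_mem _ (hS s (Multiset.mem_cons_self s τ)) _ hx
  · obtain ⟨u, hu, rfl⟩ := Multiset.mem_map.1 ht
    exact hU.inter_mem _ (hS u (Multiset.mem_cons_of_mem hu)) _ (hU.flip_mem _ hx)

/-- The infimum of `x` and the inverses of all elements of `τ`. -/
def infFlips {V : Type*} (x : OSep V) (τ : Multiset (OSep V)) : OSep V :=
  (x.1 ∩ {v | ∀ t ∈ τ, v ∈ t.2}, x.2 ∪ {v | ∃ t ∈ τ, v ∈ t.1})

lemma infFlips_zero {V : Type*} (x : OSep V) : infFlips x 0 = x := by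
  ext v <;> simp [infFlips]

lemma infFlips_cons {V : Type*} (x t : OSep V) (τ : Multiset (OSep V)) :
    infFlips x (t ::ₘ τ) = (infFlips x τ).inter t.flip := by
  ext v
  · simp only [infFlips, OSep.inter, OSep.flip, Multiset.mem_cons, forall_eq_or_imp,
      Set.mem_inter_iff, Set.mem_ofPred_eq]
    tauto
  · simp only [infFlips, OSep.inter, OSep.flip, Multiset.mem_cons, exists_eq_or_imp,
      Set.mem_union, Set.mem_ofPred_eq]
    rw [or_assoc, or_comm (b := v ∈ t.1)]

lemma IsUniverse.infFlips_mem {V : Type*} {S : Set (OSep V)} (hU : IsUniverse S)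
    {x : OSep V} (hx : x ∈ S) {τ : Multiset (OSep V)} (hS : ∀ t ∈ τ, t ∈ S) :
    infFlips x τ ∈ S := by
  induction τ using Multiset.induction_on with
  | empty => rwa [infFlips_zero]
  | cons t τ ih =>
    rw [infFlips_cons]
    exact hU.inter_mem _ (ih fun u hu => hS u (Multiset.mem_cons_of_mem hu)) _
      (hU.flip_mem _ (hS t (Multiset.mem_cons_self t τ)))

lemma Submodular.sum_union_add_le {V : Type*} {r : Set V → ℕ} (hsub : Submodular r)
    (x : OSep V) {τ : Multiset (OSep V)} (hτ : IsStar τ)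
    (hcov : ∀ t ∈ τ, t.1 ∪ t.2 = Set.univ) :
    (τ.map fun t => r (t.2 ∪ x.1)).sum + r (infFlips x τ).1 ≤
      (τ.map fun t => r t.2).sum + r x.1 := by
  induction τ using Multiset.induction_on with
  | empty => simp [infFlips_zero]
  | cons t τ ih =>
    rw [isStar_cons] at hτ
    have hih := ih hτ.2 fun u hu => hcov u (Multiset.mem_cons_of_mem hu)
    have hunion : (infFlips x τ).1 ∪ t.2 = t.2 ∪ x.1 := by
      ext v
      have hv : v ∈ t.1 ∪ t.2 := by
        rw [hcov t (Multiset.mem_cons_self t τ)]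
        trivial
      have hsubset : v ∈ t.1 → ∀ u ∈ τ, v ∈ u.2 := fun h u hu => (hτ.1 u hu).1 h
      simp only [infFlips, Set.mem_union, Set.mem_inter_iff, Set.mem_ofPred_eq] at hv ⊢
      tauto
    have hr := hsub (infFlips x τ).1 t.2
    rw [hunion] at hr
    simp only [infFlips_cons, OSep.inter, OSep.flip, Multiset.map_cons, Multiset.sum_cons]
    omega

lemma le_add_of_mem {V : Type*} {S : Set (OSep V)} (hU : IsUniverse S) {r : Set V → ℕ}
    (hsub : Submodular r) {s : OSep V} (hs : s ∈ S) : r Set.univ ≤ r s.1 + r s.2 := by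
  have h := hsub s.1 s.2
  rw [hU.covers s hs] at h
  omega

lemma IsLinkedSep.add_le_add {V : Type*} {S : Set (OSep V)} (hU : IsUniverse S)
    {r : Set V → ℕ} (hsub : Submodular r) {a x s : OSep V}
    (hx : IsLinkedSep S (ordOf r) a x) (hs : s ∈ S) (has : a.le s) (hsx : s.le x) :
    r x.1 + r x.2 ≤ r s.1 + r s.2 := by
  have hle : ordOf r x ≤ ordOf r s := by
    rw [hx.2.2]
    exact Nat.sInf_le ⟨s, ⟨hs, has, hsx⟩, rfl⟩
  have hxr := le_add_of_mem hU hsub hx.1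
  have hsr := le_add_of_mem hU hsub hs
  unfold ordOf at hle
  omega

/-- Shifting a star onto a linked separation does not increase its size. -/
lemma starSize_shiftStar_le {V : Type*} {S : Set (OSep V)} (hU : IsUniverse S)
    {r : Set V → ℕ} (hsub : Submodular r) (hmono : Monotone r) {a x s : OSep V}
    {τ : Multiset (OSep V)} (hstar : IsStar (s ::ₘ τ)) (hS : ∀ t ∈ s ::ₘ τ, t ∈ S)
    (has : a.le s) (hx : IsLinkedSep S (ordOf r) a x) :
    starSize r (shiftStar x s τ) ≤ starSize r (s ::ₘ τ) := by
  rw [isStar_cons] at hstar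
  have hSτ : ∀ t ∈ τ, t ∈ S := fun t ht => hS t (Multiset.mem_cons_of_mem ht)
  have hsum := hsub.sum_union_add_le x hstar.2 fun t ht => hU.covers t (hSτ t ht)
  have hlinked := hx.add_le_add hU hsub (hU.infFlips_mem hx.1 hSτ)
    ⟨fun v hv => ⟨hx.2.1.1 hv, fun t ht => (hstar.1 t ht).1 (has.1 hv)⟩,
      Set.union_subset hx.2.1.2 fun v ⟨t, ht, hv⟩ => has.2 ((hstar.1 t ht).2 hv)⟩
    ⟨Set.inter_subset_left, Set.subset_union_left⟩
  set Z : Set V := {v | ∃ t ∈ τ, v ∈ t.1} ∪ (s.2 ∩ x.2) with hZ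
  have hZs : r Z ≤ r s.2 := hmono
    (Set.union_subset (fun v ⟨t, ht, hv⟩ => (hstar.1 t ht).2 hv) Set.inter_subset_left)
  have hsubZ := hsub x.2 Z
  have hinter : r (s.2 ∩ x.2) ≤ r (x.2 ∩ Z) :=
    hmono fun v hv => ⟨hv.2, Or.inr hv⟩
  have hunion : x.2 ∪ Z = (infFlips x τ).2 := by
    ext v
    simp only [hZ, infFlips, Set.mem_union, Set.mem_inter_iff]
    tauto
  rw [hunion] at hsubZ
  simp only [starSize, shiftStar, OSep.union, OSep.inter, OSep.flip, Multiset.map_cons,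
    Multiset.map_map, Multiset.sum_cons, Multiset.card_cons, Multiset.card_map,
    Function.comp_def]
  exact Nat.sub_le_sub_right (by omega) _

section Tree

variable {W V : Type*} {T : SimpleGraph W}

lemma starAt_induce [Fintype W] {U : Set W} (β : T.Dart → OSep V) (s : U)
    (hs : ∀ d : T.Dart, d.toProd.2 = s → d.toProd.1 ∈ U) :
    starAt (T.induce U) (fun d => β (liftDart d)) s = starAt T β s := by
  have hinj : Function.Injective (liftDart : (T.induce U).Dart → T.Dart) := by
    intro d d' h
    have h1 := congrArg (fun d : T.Dart => d.toProd.1) h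
    have h2 := congrArg (fun d : T.Dart => d.toProd.2) h
    exact SimpleGraph.Dart.ext _ _ (Prod.ext (Subtype.ext h1) (Subtype.ext h2))
  have hmap : ((Finset.univ : Finset (T.induce U).Dart).filter fun d => d.toProd.2 = s).map
      ⟨liftDart, hinj⟩ = (Finset.univ : Finset T.Dart).filter fun d => d.toProd.2 = (s : W) := by
    ext d
    simp only [Finset.mem_map, Finset.mem_filter, Finset.mem_univ, true_and,
      Function.Embedding.coeFn_mk]
    constructor
    · rintro ⟨d', rfl, rfl⟩
      rfl
    · intro hd
      have hd2 : d.toProd.2 ∈ U := hd ▸ s.2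
      exact ⟨⟨(⟨d.toProd.1, hs d hd⟩, ⟨d.toProd.2, hd2⟩), d.adj⟩, Subtype.ext hd, rfl⟩
  unfold starAt
  rw [← hmap, Finset.map_val, Multiset.map_map]
  congr!

/-- In a tame labelled graph, consecutive edges of a path have increasing labels. -/
lemma le_of_mem_darts_cons [Fintype W] {α : T.Dart → OSep V}
    (hflip : ∀ d, α d.symm = (α d).flip) (htame : ∀ t, IsStar (starAt T α t))
    {u v w : W} (h : T.Adj u v) (q : T.Walk v w) (hp : (SimpleGraph.Walk.cons h q).IsPath)
    {d : T.Dart} (hd : d ∈ (SimpleGraph.Walk.cons h q).darts) :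
    (α ⟨(u, v), h⟩).le (α d) := by
  induction q generalizing u with
  | nil =>
    simp only [SimpleGraph.Walk.darts_cons, SimpleGraph.Walk.darts_nil,
      List.mem_singleton] at hd
    rw [hd]
    exact OSep.le_refl _
  | @cons v z w h' q ih =>
    rw [SimpleGraph.Walk.darts_cons, List.mem_cons] at hd
    rcases hd with rfl | hd
    · exact OSep.le_refl _
    refine OSep.le_trans ?_ (ih h' hp.of_cons hd)
    have huz : u ≠ z := by
      rintro rfl
      rw [SimpleGraph.Walk.cons_isPath_iff] at hp
      exact hp.2 (by simp)
    set d₁ : T.Dart := ⟨(u, v), h⟩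
    set d₂ : T.Dart := ⟨(v, z), h'⟩
    have hne : d₁ ≠ d₂.symm := fun heq =>
      huz (congrArg (fun d : T.Dart => d.toProd.1) heq)
    have hle : d₁ ::ₘ {d₂.symm} ≤
        ((Finset.univ : Finset T.Dart).filter fun d => d.toProd.2 = v).val := by
      rw [Multiset.le_iff_subset (by simpa using hne)]
      intro d hd
      simp only [Multiset.mem_cons, Multiset.mem_singleton] at hd
      rcases hd with rfl | rfl <;> simp [d₁, d₂]
    have hstar := htame v (α d₁) (α d₂.symm)
      (by simpa [starAt] using Multiset.map_le_map (f := α) hle)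
    rwa [hflip d₂] at hstar

lemma eq_of_mem_darts_of_snd_eq {u w : W} {p : T.Walk u w} (hp : p.IsPath) {d d' : T.Dart}
    (hd : d ∈ p.darts) (hd' : d' ∈ p.darts) (h : d.toProd.2 = d'.toProd.2) : d = d' := by
  have hnd : (p.darts.map fun d : T.Dart => d.toProd.2).Nodup := by
    rw [SimpleGraph.Walk.map_snd_darts]
    exact hp.support_nodup.tail
  exact List.inj_on_of_nodup_map hnd hd hd' h

lemma dartLE_of_mem_darts (hT : T.IsAcyclic) {e d : T.Dart} {p : T.Walk e.toProd.1 d.toProd.2}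
    (hp : p.IsPath) (he : e ∈ p.darts) (hd : d ∈ p.darts) : dartLE T e d := by
  intro p' hp'
  have : p' = p := congrArg Subtype.val
    ((hT.subsingleton_path _ _).elim ⟨p', hp'⟩ ⟨p, hp⟩)
  rw [this]
  exact ⟨he, hd⟩

lemma exists_dart_snd_eq {u w : W} (p : T.Walk u w) (h : u ≠ w) :
    ∃ d ∈ p.darts, d.toProd.2 = w := by
  have hmem : w ∈ p.darts.map fun d : T.Dart => d.toProd.2 := by
    rw [SimpleGraph.Walk.map_snd_darts]
    have := p.end_mem_support
    rw [SimpleGraph.Walk.mem_support_iff] at this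
    exact this.resolve_left h.symm
  simpa using hmem

lemma le_of_dartLE [Fintype W] (hT : T.IsTree) {α : T.Dart → OSep V}
    (hflip : ∀ d, α d.symm = (α d).flip) (htame : ∀ t, IsStar (starAt T α t))
    {e d : T.Dart} (h : dartLE T e d) : (α e).le (α d) := by
  obtain ⟨p, hp⟩ := (hT.connected e.toProd.1 d.toProd.2).exists_isPath
  obtain ⟨he, hd⟩ := h p hp
  obtain ⟨⟨u, v⟩, huv⟩ := e
  cases p with
  | nil => simp at he
  | @cons _ v' _ h' q =>
    have hv : (⟨(u, v), huv⟩ : T.Dart) = ⟨(u, v'), h'⟩ := by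
      rw [SimpleGraph.Walk.darts_cons, List.mem_cons] at he
      refine he.resolve_right fun heq => ?_
      rw [SimpleGraph.Walk.cons_isPath_iff] at hp
      exact hp.2 (q.dart_fst_mem_support_of_mem_darts heq)
    rw [hv]
    exact le_of_mem_darts_cons hflip htame h' q hp hd

lemma fst_mem_shiftSet {e d : T.Dart} (hd : d.toProd.2 ∈ shiftSet T e)
    (hne : d.toProd.2 ≠ e.toProd.1) : d.toProd.1 ∈ shiftSet T e := by
  have hs := hd.resolve_left hne
  by_cases hde : d.toProd.1 = e.toProd.1
  · exact Or.inl hde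
  refine Or.inr fun p hp => ?_
  by_cases hmem : d.toProd.2 ∈ p.support
  · exact p.darts_takeUntil_subset_darts hmem (hs _ (hp.takeUntil hmem))
  · have he := hs (p.concat d.adj) (hp.concat hmem d.adj)
    rw [SimpleGraph.Walk.darts_concat, List.concat_eq_append, List.mem_append,
      List.mem_singleton] at he
    refine he.resolve_right fun heq => hde ?_
    rw [heq]

/-- The star at a vertex of a shifted tree is the shift of the star at that vertex. -/
lemma exists_starAt_shiftAlpha [Fintype W] (hT : T.IsTree) {α : T.Dart → OSep V}
    (hflip : ∀ d, α d.symm = (α d).flip) (htame : ∀ t, IsStar (starAt T α t)) {e : T.Dart}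
    (x : OSep V) (s : shiftSet T e) (hs : (s : W) ≠ e.toProd.1) :
    ∃ (b : OSep V) (τ : Multiset (OSep V)), (α e).le b ∧ starAt T α s = b ::ₘ τ ∧
      starAt (T.induce (shiftSet T e)) (shiftAlpha T α e x) s = shiftStar x b τ := by
  obtain ⟨p, hp⟩ := (hT.connected e.toProd.1 s).exists_isPath
  have he : e ∈ p.darts := s.2.resolve_left hs p hp
  obtain ⟨d₀, hd₀, hd₀s⟩ := exists_dart_snd_eq p hs.symm
  have hle : dartLE T e d₀ := by
    have hcopy : ∀ w (_ : d₀.toProd.2 = w) (q : T.Walk e.toProd.1 w), q.IsPath →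
        e ∈ q.darts → d₀ ∈ q.darts → dartLE T e d₀ := by
      rintro w rfl q hq heq hdq
      exact dartLE_of_mem_darts hT.isAcyclic hq heq hdq
    exact hcopy _ hd₀s p hp he hd₀
  have huniq : ∀ d : T.Dart, d.toProd.2 = s → d ≠ d₀ → ¬ dartLE T e d := by
    intro d hd hdne hdle
    have hcopy : ∀ w (_ : d.toProd.2 = w) (q : T.Walk e.toProd.1 w), q.IsPath →
        d ∈ q.darts := by
      rintro w rfl q hq
      exact (hdle q hq).2
    exact hdne (eq_of_mem_darts_of_snd_eq hp (hcopy _ hd p hp) hd₀ (hd.trans hd₀s.symm))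
  set D := (Finset.univ : Finset T.Dart).filter fun d => d.toProd.2 = (s : W) with hD
  have hDins : D.val = d₀ ::ₘ (D.erase d₀).val := by
    rw [Finset.erase_val, Multiset.cons_erase]
    simp [hD, hd₀s]
  refine ⟨α d₀, (D.erase d₀).val.map α, le_of_dartLE hT hflip htame hle, ?_, ?_⟩
  · rw [starAt, ← hD, hDins, Multiset.map_cons]
  · have hind := starAt_induce
      (fun d => if dartLE T e d then (α d).union x else ((α d.symm).union x).flip) s
      fun d hd => fst_mem_shiftSet (hd ▸ s.2) (hd ▸ hs)
    refine hind.trans ?_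
    rw [starAt, ← hD, hDins, Multiset.map_cons, if_pos hle, shiftStar, Multiset.map_map]
    congr 1
    refine Multiset.map_congr rfl fun d hd => ?_
    rw [Finset.mem_val, Finset.mem_erase, hD, Finset.mem_filter] at hd
    rw [if_neg (huniq d hd.2.2 hd.1), hflip]
    rfl

end Tree

/-- Lemma `l:shift2`. The family `F_p` of stars of size `< p` is fixed
under shifting; in particular the explicit shift
`σ' = {(A₀ ∪ X, B₀ ∩ Y), (A₁ ∩ Y, B₁ ∪ X), …, (Aₙ ∩ Y, Bₙ ∪ X)}` of a star
`σ = {(A₀,B₀), …, (Aₙ,Bₙ)}` onto a separation `(X,Y)` linked to some `(A,B) ≤ (A₀,B₀)`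
satisfies `⟨σ'⟩_r ≤ ⟨σ⟩_r`. -/
theorem Fp_fixedUnderShifting {V : Type*} [Fintype V] (S : Set (OSep V)) (r : Set V → ℕ)
    (hU : IsUniverse S) (hsub : Submodular r) (hmono : Monotone r) (p : ℕ) :
    FixedUnderShifting S (ordOf r)
      {σ | IsStar σ ∧ (∀ s ∈ σ, s ∈ S) ∧ starSize r σ < p} ∧
    ∀ (m : ℕ) (A B : Fin (m + 1) → Set V) (a x : OSep V),
      IsStar (Multiset.map (fun i => ((A i, B i) : OSep V)) (Finset.univ : Finset (Fin (m + 1))).val) →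
      (∀ i, ((A i, B i) : OSep V) ∈ S) → a ∈ S →
      OSep.le a (A 0, B 0) → IsLinkedSep S (ordOf r) a x →
      starSize r (((A 0 ∪ x.1, B 0 ∩ x.2) : OSep V) ::ₘ
          Multiset.map (fun i : Fin m => ((A i.succ ∩ x.2, B i.succ ∪ x.1) : OSep V))
            (Finset.univ : Finset (Fin m)).val) ≤
        starSize r (Multiset.map (fun i => ((A i, B i) : OSep V))
          (Finset.univ : Finset (Fin (m + 1))).val) := by
  refine ⟨?_, ?_⟩
  · rintro n T α e x s hT hflip - htame hs ⟨hstar, hS, hsize⟩ hx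
    obtain ⟨b, τ, hb, hσ, hσ'⟩ := exists_starAt_shiftAlpha hT hflip htame x s hs
    rw [hσ] at hstar hS hsize
    rw [hσ']
    exact ⟨hstar.shiftStar, hU.mem_of_mem_shiftStar hx.1 hS,
      (starSize_shiftStar_le hU hsub hmono hstar hS hb hx).trans_lt hsize⟩
  · intro m A B a x hstar hS _ ha hx
    have hcons : Multiset.map (fun i => ((A i, B i) : OSep V))
        (Finset.univ : Finset (Fin (m + 1))).val = (A 0, B 0) ::ₘ
          Multiset.map (fun i : Fin m => ((A i.succ, B i.succ) : OSep V))
            (Finset.univ : Finset (Fin m)).val := by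
      rw [Fin.univ_succ, Finset.cons_val, Multiset.map_cons, Finset.map_val, Multiset.map_map]
      rfl
    rw [hcons] at hstar ⊢
    have h := starSize_shiftStar_le hU hsub hmono hstar (fun t ht => ?_) ha hx
    · rwa [shiftStar, Multiset.map_map] at h
    · rw [← hcons] at ht
      obtain ⟨i, -, rfl⟩ := Multiset.mem_map.1 ht
      exact hS i
end
end

section
/- Let S⃗ be the universe of oriented separations of a finite graph G. If (T,α) is a tame S-tree, then (T,𝒱)_α with bags V_t = int(σ_t) is a tree-decomposition of G; furthermore, if α(t,t') = (A,B) for an oriented edge (t,t') of T, then V_t ∩ V_{t'} = A ∩ B. -/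
open scoped Classical

noncomputable section

lemma mem_intStar_starAt {W V : Type*} [Fintype W] {T : SimpleGraph W} {α : T.Dart → OSep V}
    (hinv : ∀ d, α d.symm = (α d).flip) {t : W} {v : V} :
    v ∈ intStar (starAt T α t) ↔ ∀ d : T.Dart, d.fst = t → v ∈ (α d).1 := by
  simp only [intStar, starAt, Set.mem_ofPred_eq, Multiset.mem_map, Finset.mem_val,
    Finset.mem_filter, Finset.mem_univ, true_and, forall_exists_index, and_imp,
    forall_apply_eq_imp_iff₂]
  constructor
  · intro h d hd
    have := h d.symm hd
    rwa [hinv] at this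
  · intro h d hd
    have := h d.symm hd
    rwa [hinv] at this

lemma label_fst_subset_of_consecutive {W V : Type*} [Fintype W] {T : SimpleGraph W}
    {α : T.Dart → OSep V} (hinv : ∀ d, α d.symm = (α d).flip)
    (htame : ∀ t, IsStar (starAt T α t)) {e f : T.Dart} (hef : e.snd = f.fst)
    (hne : e.fst ≠ f.snd) : (α e).1 ⊆ (α f).1 := by
  have hne' : e ≠ f.symm := fun h => hne (by rw [h]; rfl)
  have hle : (α e ::ₘ {α f.symm}) ≤ starAt T α f.fst := by
    have hsub : (e ::ₘ {f.symm}) ≤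
        ((Finset.univ : Finset T.Dart).filter fun d => d.toProd.2 = f.fst).val := by
      rw [Multiset.le_iff_subset (by simpa using hne')]
      intro d hd
      simp only [Multiset.mem_cons, Multiset.mem_singleton] at hd
      rcases hd with rfl | rfl <;> simp [hef]
    simpa [starAt] using Multiset.map_le_map (f := α) hsub
  have h := (htame f.fst _ _ hle).1
  rwa [hinv] at h

lemma mem_label_fst_of_isPath_cons {W V : Type*} [Fintype W] {T : SimpleGraph W}
    {α : T.Dart → OSep V} (hinv : ∀ d, α d.symm = (α d).flip)
    (htame : ∀ t, IsStar (starAt T α t)) {v : V} {d : T.Dart} {a b c : W} (h : T.Adj a c)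
    (p : T.Walk c b) (hp : (SimpleGraph.Walk.cons h p).IsPath) (hd : d.fst = b)
    (hds : d.snd ∉ (SimpleGraph.Walk.cons h p).support) (hv : v ∈ (α ⟨(a, c), h⟩).1) :
    v ∈ (α d).1 := by
  induction p generalizing a with
  | nil =>
    refine label_fst_subset_of_consecutive hinv htame hd.symm ?_ hv
    rintro rfl
    simp at hds
  | cons h' q ih =>
    rw [SimpleGraph.Walk.cons_isPath_iff] at hp
    rw [SimpleGraph.Walk.support_cons, List.mem_cons, not_or] at hds
    refine ih h' hp.1 hd hds.2 (label_fst_subset_of_consecutive hinv htame rfl ?_ hv)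
    rintro rfl
    exact hp.2 (by simp)

lemma mem_label_fst_of_isPath {W V : Type*} [Fintype W] {T : SimpleGraph W}
    {α : T.Dart → OSep V} (hinv : ∀ d, α d.symm = (α d).flip)
    (htame : ∀ t, IsStar (starAt T α t)) {v : V} {d : T.Dart} {a b : W}
    (p : T.Walk a b) (hp : p.IsPath) (hd : d.fst = b) (hds : d.snd ∉ p.support)
    (hv : v ∈ intStar (starAt T α a)) : v ∈ (α d).1 := by
  rw [mem_intStar_starAt hinv] at hv
  cases p with
  | nil => exact hv d hd
  | cons h q => exact mem_label_fst_of_isPath_cons hinv htame h q hp hd hds (hv _ rfl)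

/-- Every choice of an outgoing dart at each vertex of a finite tree chooses both orientations
of some edge. -/
lemma SimpleGraph.IsTree.exists_symm_eq {W : Type*} [Fintype W] {T : SimpleGraph W}
    (hT : T.IsTree) (f : W → T.Dart) (hf : ∀ t, (f t).fst = t) :
    ∃ s t, f s = (f t).symm := by
  have hcard := hT.card_edgeFinset
  obtain ⟨s, -, t, -, hst, heq⟩ := Finset.exists_ne_map_eq_of_card_lt_of_maps_to
    (s := Finset.univ) (t := T.edgeFinset) (f := fun t => (f t).edge)
    (by rw [Finset.card_univ]; omega)
    (fun t _ => by simp)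
  refine ⟨s, t, ((SimpleGraph.dart_edge_eq_iff _ _).1 heq).resolve_left fun h => hst ?_⟩
  rw [← hf s, ← hf t, h]

lemma exists_subset_intStar_starAt {W V : Type*} [Fintype W] {T : SimpleGraph W}
    (hT : T.IsTree) {α : T.Dart → OSep V} (hinv : ∀ d, α d.symm = (α d).flip) {U : Set V}
    (hU : ∀ d, U ⊆ (α d).1 ∨ U ⊆ (α d).2) : ∃ t, U ⊆ intStar (starAt T α t) := by
  by_contra! h
  have hout : ∀ t, ∃ d : T.Dart, d.fst = t ∧ ¬ U ⊆ (α d).1 := by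
    intro t
    obtain ⟨v, hvU, hv⟩ := Set.not_subset.1 (h t)
    rw [mem_intStar_starAt hinv] at hv
    push Not at hv
    obtain ⟨d, hd, hvd⟩ := hv
    exact ⟨d, hd, fun hs => hvd (hs hvU)⟩
  choose f hf hfU using hout
  obtain ⟨s, t, hst⟩ := hT.exists_symm_eq f hf
  have hs := hfU s
  rw [hst, hinv] at hs
  exact (hU (f t)).elim (hfU t) hs

lemma pair_subset_of_mem_graphSeps {V : Type*} {G : SimpleGraph V} {s : OSep V}
    (hs : s ∈ graphSeps G) {u w : V} (huw : G.Adj u w) :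
    ({u, w} : Set V) ⊆ s.1 ∨ ({u, w} : Set V) ⊆ s.2 := by
  have hu : u ∈ s.1 ∪ s.2 := hs.1 ▸ Set.mem_univ u
  have hw : w ∈ s.1 ∪ s.2 := hs.1 ▸ Set.mem_univ w
  have h₁ := hs.2 u
  have h₂ := hs.2 w
  have hwu := huw.symm
  simp only [Set.insert_subset_iff, Set.singleton_subset_iff, Set.mem_union, Set.mem_sdiff]
    at *
  grind

/-- Lemma `l:build`. If `(T,α)` is a tame `S`-tree over the universe of
separations of a graph `G`, then the bags `V_t = int(σ_t)` form a tree-decomposition of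
`G`, and if `α(t,t') = (A,B)` then `V_t ∩ V_{t'} = A ∩ B`. -/
theorem stree_gives_treeDecomposition {V : Type*} [Fintype V] (G : SimpleGraph V)
    (n : ℕ) (T : SimpleGraph (Fin n)) (hT : T.IsTree) (α : T.Dart → OSep V)
    (hinv : ∀ d, α d.symm = (α d).flip) (hrange : ∀ d, α d ∈ graphSeps G)
    (htame : ∀ t, IsStar (starAt T α t)) :
    IsTreeDecomp G T (fun t => intStar (starAt T α t)) ∧
    ∀ d : T.Dart,
      intStar (starAt T α d.toProd.1) ∩ intStar (starAt T α d.toProd.2) =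
        (α d).1 ∩ (α d).2 := by
  refine ⟨⟨hT, fun v => ?_, fun u w huw => ?_, ?_⟩, fun d => ?_⟩
  · obtain ⟨t, ht⟩ := exists_subset_intStar_starAt hT hinv (U := {v}) fun d => by
      have hv : v ∈ (α d).1 ∪ (α d).2 := (hrange d).1 ▸ Set.mem_univ v
      simpa using hv
    exact ⟨t, ht rfl⟩
  · obtain ⟨t, ht⟩ := exists_subset_intStar_starAt hT hinv (U := {u, w})
      fun d => pair_subset_of_mem_graphSeps (hrange d) huw
    exact ⟨t, ht (by simp), ht (by simp)⟩
  · rintro t₁ t₂ t₃ p hp ht₂ v ⟨hv₁, hv₃⟩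
    refine (mem_intStar_starAt hinv).2 fun d hd => ?_
    by_cases hmem : d.snd ∈ (p.takeUntil t₂ ht₂).support
    · refine mem_label_fst_of_isPath hinv htame (p.dropUntil t₂ ht₂).reverse
        (hp.dropUntil ht₂).reverse hd ?_ hv₃
      rw [SimpleGraph.Walk.support_reverse, List.mem_reverse]
      intro hmem'
      have hne : d.snd ≠ t₂ := hd ▸ d.adj.ne'
      rw [← p.take_spec ht₂] at hp
      have hnodup := hp.support_nodup
      rw [SimpleGraph.Walk.support_append] at hnodup
      rw [SimpleGraph.Walk.mem_support_iff] at hmem'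
      exact List.disjoint_of_nodup_append hnodup hmem (hmem'.resolve_left hne)
    · exact mem_label_fst_of_isPath hinv htame _ (hp.takeUntil ht₂) hd hmem hv₁
  · ext v
    simp only [Set.mem_inter_iff, mem_intStar_starAt hinv]
    constructor
    · rintro ⟨h₁, h₂⟩
      have h := h₂ d.symm rfl
      rw [hinv] at h
      exact ⟨h₁ d rfl, h⟩
    · rintro ⟨h₁, h₂⟩
      have h₂' : v ∈ (α d.symm).1 := by rw [hinv]; exact h₂
      refine ⟨fun f hf => ?_, fun f hf => ?_⟩
      · by_cases hfd : d.snd = f.snd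
        · rwa [show f = d from SimpleGraph.Dart.ext _ _ (Prod.ext hf hfd.symm)]
        · exact label_fst_subset_of_consecutive hinv htame (e := d.symm) hf.symm hfd h₂'
      · by_cases hfd : d.fst = f.snd
        · rwa [show f = d.symm from SimpleGraph.Dart.ext _ _ (Prod.ext hf hfd.symm)]
        · exact label_fst_subset_of_consecutive hinv htame (e := d) hf.symm hfd h₁
end
end
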